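/- arXiv:1502.03840 — 3 statements merged into one kernel-verified Lean document; each statement's English description precedes it below -/
import Mathlib

section
/- Under the optimal-price first-order condition, the uniform profit r(v) tends to +∞ as v tends to +∞ (part of the market-share convergence lemma). -/
open Filter Real

/-- The upper bound for the factor multiplying `α₂ * r v` in the first-order condition vanishes
as the attraction grows. -/
theorem tendsto_foc_weight (β₁ q₀ C : ℝ) (hβ₁ : 0 < β₁) :
    Tendsto (fun k : ℝ => β₁ * (C / ((q₀ + k) ^ β₁ + C)) + q₀ / (q₀ + k)) atTop (nhds 0) := by
  have h1 : Tendsto (fun k : ℝ => q₀ + k) atTop atTop := tendsto_atTop_add_const_left _ _ tendsto_id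
  have h2 : Tendsto (fun k : ℝ => (q₀ + k) ^ β₁ + C) atTop atTop :=
    tendsto_atTop_add_const_right _ _ ((tendsto_rpow_atTop hβ₁).comp h1)
  simpa using ((h2.const_div_atTop C).const_mul β₁).add (h1.const_div_atTop q₀)

theorem statement_3
    (α₂ β₁ q₀ C : ℝ) (hα₂ : 0 < α₂) (hβ₁ : 0 < β₁) (hq₀ : 0 < q₀) (hC : 0 < C)
    (r : ℝ → ℝ) (hr : ∀ v, 0 < v → 0 < r v)
    (κ η P₀ : ℝ → ℝ)
    (hκ : ∀ v, 0 < v → κ v = v * Real.exp (-(α₂ * r v)))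
    (hη : ∀ v, 0 < v → η v = (q₀ + κ v) ^ β₁ / ((q₀ + κ v) ^ β₁ + C))
    (hP₀ : ∀ v, 0 < v → P₀ v = q₀ / (q₀ + κ v))
    (hfoc : ∀ v, 0 < v →
      α₂ * β₁ * r v * (1 - η v) * (1 - P₀ v) + α₂ * r v * P₀ v = 1) :
    Tendsto r atTop atTop := by
  refine tendsto_atTop.2 fun B => ?_
  have hlim : Tendsto (fun v : ℝ => v * Real.exp (-(α₂ * B))) atTop atTop :=
    tendsto_id.atTop_mul_const (Real.exp_pos _)
  have hG := (((tendsto_foc_weight β₁ q₀ C hβ₁).comp hlim).const_mul (α₂ * B)).eventually_lt_const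
    (show α₂ * B * 0 < 1 by simp)
  filter_upwards [hG, eventually_gt_atTop 0] with v hv hv0
  by_contra! hB
  have hrv := hr v hv0
  simp only [Function.comp_apply] at hv
  set k := v * Real.exp (-(α₂ * B)) with hk
  have hk0 : 0 < k := by positivity
  have hkκ : k ≤ κ v := by
    rw [hκ v hv0, hk]
    gcongr
  have hκ0 : 0 < κ v := hk0.trans_le hkκ
  have hpow : 0 < (q₀ + κ v) ^ β₁ := by positivity
  have h1η : 1 - η v = C / ((q₀ + κ v) ^ β₁ + C) := by
    rw [hη v hv0]
    field_simp
    ring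
  have hηk : 1 - η v ≤ C / ((q₀ + k) ^ β₁ + C) := by
    rw [h1η]
    gcongr
  have hη0 : 0 ≤ 1 - η v := by
    rw [h1η]
    positivity
  have hPk : P₀ v ≤ q₀ / (q₀ + k) := by
    rw [hP₀ v hv0]
    gcongr
  have hP0 : 0 ≤ P₀ v := by
    rw [hP₀ v hv0]
    positivity
  have hweight : β₁ * ((1 - η v) * (1 - P₀ v)) + P₀ v ≤
      β₁ * (C / ((q₀ + k) ^ β₁ + C)) + q₀ / (q₀ + k) := by
    gcongr
    exact (mul_le_of_le_one_right hη0 (by linarith)).trans hηk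
  have hle : α₂ * r v * (β₁ * ((1 - η v) * (1 - P₀ v)) + P₀ v) ≤
      α₂ * B * (β₁ * (C / ((q₀ + k) ^ β₁ + C)) + q₀ / (q₀ + k)) :=
    (mul_le_mul_of_nonneg_left hweight (by positivity)).trans
      (mul_le_mul_of_nonneg_right (by gcongr) (by positivity))
  linarith [hfoc v hv0]
end

section
/- Implicit differentiation of the first-order condition: if v > 0 and r has derivative r′(v) at v, then α₂·v·(H(v) + β₁·(1 − η(v))·(1 − P₀(v)) + P₀(v))·r′(v) = H(v); equivalently, when H(v) ≠ 0, r′(v) = 1/(α₂·v·(1 + h(v))). -/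
open Filter Real

/-- A logit-type share `q₀ / (q₀ + κ)` has derivative `-P (1 - P) L`, where `L` is the logarithmic
derivative of `κ`. -/
lemma HasDerivAt.const_div_const_add {κ : ℝ → ℝ} {q L v : ℝ} (hq : q + κ v ≠ 0)
    (hκ : HasDerivAt κ (κ v * L) v) :
    HasDerivAt (fun x => q / (q + κ x))
      (-(q / (q + κ v)) * (1 - q / (q + κ v)) * L) v := by
  refine ((hasDerivAt_const v q).div (hκ.const_add q) hq).congr_deriv ?_
  field_simp
  ring

/-- The derivative of `y ^ β / (y ^ β + C)` with `y = q + κ`, in terms of the logarithmic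
derivative `L` of `κ`. -/
lemma HasDerivAt.rpow_div_rpow_add_const {κ : ℝ → ℝ} {q β C L v : ℝ} (hq : 0 < q + κ v)
    (hC : 0 < C) (hκ : HasDerivAt κ (κ v * L) v) :
    HasDerivAt (fun x => (q + κ x) ^ β / ((q + κ x) ^ β + C))
      (β * ((q + κ v) ^ β / ((q + κ v) ^ β + C)) * (1 - (q + κ v) ^ β / ((q + κ v) ^ β + C))
        * (1 - q / (q + κ v)) * L) v := by
  have hpow : HasDerivAt (fun x => (q + κ x) ^ β) (κ v * L * β * (q + κ v) ^ (β - 1)) v :=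
    (hκ.const_add q).rpow_const (Or.inl hq.ne')
  have hy : 0 < (q + κ v) ^ β := Real.rpow_pos_of_pos hq β
  have hden : (q + κ v) ^ β + C ≠ 0 := by positivity
  refine (hpow.div (hpow.add_const C) hden).congr_deriv ?_
  rw [Real.rpow_sub_one hq.ne']
  have hq' := hq.ne'
  generalize (q + κ v) ^ β = y at *
  field_simp
  ring

theorem statement_8
    (α₂ β₁ q₀ C : ℝ) (hα₂ : 0 < α₂) (hβ₁ : 0 < β₁) (hq₀ : 0 < q₀) (hC : 0 < C)
    (r : ℝ → ℝ) (hr : ∀ v, 0 < v → 0 < r v)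
    (κ η P₀ : ℝ → ℝ)
    (hκ : ∀ v, 0 < v → κ v = v * Real.exp (-(α₂ * r v)))
    (hη : ∀ v, 0 < v → η v = (q₀ + κ v) ^ β₁ / ((q₀ + κ v) ^ β₁ + C))
    (hP₀ : ∀ v, 0 < v → P₀ v = q₀ / (q₀ + κ v))
    (hfoc : ∀ v, 0 < v →
      α₂ * β₁ * r v * (1 - η v) * (1 - P₀ v) + α₂ * r v * P₀ v = 1)
    (H : ℝ → ℝ)
    (hH : ∀ v, 0 < v → H v =
      α₂ * β₁ ^ 2 * r v * η v * (1 - η v) * (1 - P₀ v) ^ 2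
      - α₂ * β₁ * r v * (1 - η v) * P₀ v * (1 - P₀ v)
      + α₂ * r v * P₀ v * (1 - P₀ v))
    (h : ℝ → ℝ)
    (hh : ∀ v, 0 < v → h v = (β₁ * (1 - η v) * (1 - P₀ v) + P₀ v) / H v)
    (v r' : ℝ) (hv : 0 < v) (hr' : HasDerivAt r r' v) :
    α₂ * v * (H v + β₁ * (1 - η v) * (1 - P₀ v) + P₀ v) * r' = H v ∧
    (H v ≠ 0 → r' = 1 / (α₂ * v * (1 + h v))) := by
  have hpos : ∀ᶠ x in nhds v, 0 < x := lt_mem_nhds hv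
  have hκv : 0 < κ v := by rw [hκ v hv]; positivity
  have hqκ : 0 < q₀ + κ v := by positivity
  have dκ : HasDerivAt κ (κ v * (1 / v - α₂ * r')) v := by
    refine HasDerivAt.congr_of_eventuallyEq (f := fun x => x * Real.exp (-(α₂ * r x))) ?_
      (hpos.mono hκ)
    refine ((hasDerivAt_id v).mul (hr'.const_mul α₂).neg.exp).congr_deriv ?_
    rw [hκ v hv]
    simp only [id, Pi.neg_apply]
    field_simp
    ring
  have dP : HasDerivAt P₀ (-(P₀ v) * (1 - P₀ v) * (1 / v - α₂ * r')) v := by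
    rw [hP₀ v hv]
    exact (dκ.const_div_const_add hqκ.ne').congr_of_eventuallyEq (hpos.mono hP₀)
  have dη : HasDerivAt η (β₁ * η v * (1 - η v) * (1 - P₀ v) * (1 / v - α₂ * r')) v := by
    rw [hP₀ v hv, hη v hv]
    exact (dκ.rpow_div_rpow_add_const hqκ hC).congr_of_eventuallyEq (hpos.mono hη)
  have dfoc := (((hr'.const_mul (α₂ * β₁)).mul (dη.const_sub 1)).mul (dP.const_sub 1)).add
    ((hr'.const_mul α₂).mul dP)
  have dzero := dfoc.unique
    ((hasDerivAt_const v (1 : ℝ)).congr_of_eventuallyEq (hpos.mono hfoc))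
  simp only [Pi.mul_apply] at dzero
  have key : α₂ * r' * (β₁ * (1 - η v) * (1 - P₀ v) + P₀ v) = H v * (1 / v - α₂ * r') := by
    rw [hH v hv]
    linear_combination dzero
  have main : α₂ * v * (H v + β₁ * (1 - η v) * (1 - P₀ v) + P₀ v) * r' = H v := by
    have hvinv : v * (1 / v) = 1 := mul_one_div_cancel hv.ne'
    linear_combination v * key + H v * hvinv
  refine ⟨main, fun hH0 => ?_⟩
  have hsum : H v + β₁ * (1 - η v) * (1 - P₀ v) + P₀ v ≠ 0 := by
    intro h0
    rw [h0] at main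
    exact hH0 (by linarith)
  have hone : 1 + h v = (H v + β₁ * (1 - η v) * (1 - P₀ v) + P₀ v) / H v := by
    rw [hh v hv]
    field_simp
    ring
  rw [hone]
  generalize H v + β₁ * (1 - η v) * (1 - P₀ v) + P₀ v = S at *
  field_simp
  linarith
end

section
/- Assume in addition that r is twice differentiable on (0, +∞). Then there exists v̄₂ > 0 such that the second derivative of the operational profit Π is strictly negative on (v̄₂, +∞); in particular Π is (strictly) concave on (v̄₂, +∞). -/
open Filter Real

/-- The no-purchase probability at aggregate attraction `k`. -/
noncomputable def noPurchase (q k : ℝ) : ℝ := q / (q + k)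

/-- One minus the arrival probability at aggregate attraction `k`. -/
noncomputable def noArrival (q β C k : ℝ) : ℝ := C / ((q + k) ^ β + C)

/-- Elasticity in `k` of the sale probability `(1 - noArrival) * (1 - noPurchase)`. -/
noncomputable def saleElasticity (q β C k : ℝ) : ℝ :=
  β * noArrival q β C k * (1 - noPurchase q k) + noPurchase q k

lemma hasDerivAt_noPurchase {q k : ℝ} (hq : 0 < q) (hk : 0 < k) :
    HasDerivAt (noPurchase q) (-(noPurchase q k / (q + k))) k := by
  have hqk : q + k ≠ 0 := by positivity
  have h := (hasDerivAt_const k q).fun_div ((hasDerivAt_id k).const_add q) hqk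
  refine h.congr_deriv ?_
  simp only [noPurchase, id]
  field_simp
  ring

lemma hasDerivAt_noArrival {q β C k : ℝ} (hq : 0 < q) (hC : 0 < C) (hk : 0 < k) :
    HasDerivAt (noArrival q β C)
      (-(β * noArrival q β C k * (1 - noArrival q β C k) / (q + k))) k := by
  have hqk : 0 < q + k := by positivity
  have hM : 0 < (q + k) ^ β := rpow_pos_of_pos hqk β
  have hpow : HasDerivAt (fun x => (q + x) ^ β) (β * (q + k) ^ β / (q + k)) k := by
    refine (((hasDerivAt_id k).const_add q).rpow_const (p := β) (Or.inl hqk.ne')).congr_deriv ?_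
    simp only [id, rpow_sub_one hqk.ne']
    ring
  refine ((hasDerivAt_const k C).fun_div (hpow.add_const C) (by positivity)).congr_deriv ?_
  simp only [noArrival]
  have hMC : (q + k) ^ β + C ≠ 0 := by positivity
  generalize (q + k) ^ β = M at *
  field_simp
  ring

lemma noPurchase_pos {q k : ℝ} (hq : 0 < q) (hk : 0 < k) : 0 < noPurchase q k := by
  unfold noPurchase; positivity

lemma noPurchase_lt_one {q k : ℝ} (hq : 0 < q) (hk : 0 < k) : noPurchase q k < 1 := by
  unfold noPurchase
  rw [div_lt_one (by positivity)]
  linarith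

lemma noArrival_pos {q β C k : ℝ} (hq : 0 < q) (hC : 0 < C) (hk : 0 < k) :
    0 < noArrival q β C k := by
  unfold noArrival; positivity

lemma noArrival_lt_one {q β C k : ℝ} (hq : 0 < q) (hC : 0 < C) (hk : 0 < k) :
    noArrival q β C k < 1 := by
  have hM : 0 < (q + k) ^ β := rpow_pos_of_pos (by positivity) β
  unfold noArrival
  rw [div_lt_one (by positivity)]
  linarith

lemma mul_noArrival_lt_one {q β C k : ℝ} (hq : 0 < q) (hC : 0 < C) (hk : 0 < k)
    (hM : β * C < (q + k) ^ β) : β * noArrival q β C k < 1 := by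
  have hM' : 0 < (q + k) ^ β := rpow_pos_of_pos (by positivity) β
  unfold noArrival
  rw [← mul_div_assoc, div_lt_one (by positivity)]
  linarith

lemma hasDerivAt_sale {q β C k : ℝ} (hq : 0 < q) (hC : 0 < C) (hk : 0 < k) :
    HasDerivAt (fun x => (1 - noArrival q β C x) * (1 - noPurchase q x))
      ((1 - noArrival q β C k) * (1 - noPurchase q k) * saleElasticity q β C k / k) k := by
  refine (((hasDerivAt_noArrival hq hC hk).const_sub 1).fun_mul
    ((hasDerivAt_noPurchase hq hk).const_sub 1)).congr_deriv ?_
  have hqk : q + k ≠ 0 := by positivity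
  unfold saleElasticity
  generalize noArrival q β C k = s
  simp only [noPurchase]
  field_simp
  ring

lemma exists_hasDerivAt_saleElasticity_nonpos {q β C k : ℝ} (hq : 0 < q) (hβ : 0 < β)
    (hC : 0 < C) (hk : 0 < k) (hM : β * C < (q + k) ^ β) :
    ∃ d ≤ 0, HasDerivAt (saleElasticity q β C) d k := by
  have hw := noPurchase_pos hq hk
  have hw' := noPurchase_lt_one hq hk
  have hs := noArrival_pos (β := β) hq hC hk
  have hs' := noArrival_lt_one (β := β) hq hC hk
  have hβs := mul_noArrival_lt_one hq hC hk hM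
  refine ⟨_, ?_, (((hasDerivAt_noArrival hq hC hk).const_mul β).fun_mul
    ((hasDerivAt_noPurchase hq hk).const_sub 1)).fun_add (hasDerivAt_noPurchase hq hk)⟩
  generalize noPurchase q k = w at *
  generalize noArrival q β C k = s at *
  have h₁ : 0 ≤ β * (β * s * (1 - s) / (q + k)) * (1 - w) := by
    have := sub_pos.2 hw'
    have := sub_pos.2 hs'
    positivity
  have h₂ : 0 ≤ (1 - β * s) * (w / (q + k)) := mul_nonneg (by linarith) (by positivity)
  linarith

lemma saleElasticity_lt_one {q β C k : ℝ} (hq : 0 < q)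
    (hC : 0 < C) (hk : 0 < k) (hM : β * C < (q + k) ^ β) : saleElasticity q β C k < 1 := by
  have hw' := noPurchase_lt_one hq hk
  have hβs := mul_noArrival_lt_one hq hC hk hM
  unfold saleElasticity
  nlinarith

lemma noPurchase_lt_saleElasticity {q β C k : ℝ} (hq : 0 < q) (hβ : 0 < β)
    (hC : 0 < C) (hk : 0 < k) : noPurchase q k < saleElasticity q β C k := by
  have hs := noArrival_pos (β := β) hq hC hk
  have := sub_pos.2 (noPurchase_lt_one hq hk)
  unfold saleElasticity
  have : 0 < β * noArrival q β C k * (1 - noPurchase q k) := by positivity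
  linarith


theorem statement_15
    (α₂ β₁ q₀ C : ℝ) (hα₂ : 0 < α₂) (hβ₁ : 0 < β₁) (hq₀ : 0 < q₀) (hC : 0 < C)
    (r : ℝ → ℝ) (hr : ∀ v, 0 < v → 0 < r v)
    (κ η P₀ : ℝ → ℝ)
    (hκ : ∀ v, 0 < v → κ v = v * Real.exp (-(α₂ * r v)))
    (hη : ∀ v, 0 < v → η v = (q₀ + κ v) ^ β₁ / ((q₀ + κ v) ^ β₁ + C))
    (hP₀ : ∀ v, 0 < v → P₀ v = q₀ / (q₀ + κ v))
    (hfoc : ∀ v, 0 < v →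
      α₂ * β₁ * r v * (1 - η v) * (1 - P₀ v) + α₂ * r v * P₀ v = 1)
    (hdiff : DifferentiableOn ℝ r (Set.Ioi 0))
    (hdiff2 : DifferentiableOn ℝ (deriv r) (Set.Ioi 0))
    (Prof : ℝ → ℝ) (hProf : ∀ v, 0 < v → Prof v = r v * η v * (1 - P₀ v)) :
    ∃ vbar₂ > (0 : ℝ), (∀ v, vbar₂ < v → deriv (deriv Prof) v < 0) ∧
    StrictConcaveOn ℝ (Set.Ioi vbar₂) Prof := by
  have hκpos : ∀ v, 0 < v → 0 < κ v := fun v hv => by rw [hκ v hv]; positivity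
  have hη' : ∀ v, 0 < v → η v = 1 - noArrival q₀ β₁ C (κ v) := fun v hv => by
    have := hκpos v hv
    have hMC : (q₀ + κ v) ^ β₁ + C ≠ 0 := by positivity
    rw [hη v hv, noArrival]
    field_simp
    ring
  have hfoc' : ∀ v, 0 < v → α₂ * r v * saleElasticity q₀ β₁ C (κ v) = 1 := fun v hv => by
    rw [← hfoc v hv, hη' v hv, hP₀ v hv, saleElasticity, noPurchase]
    ring
  have hProf' : ∀ v, 0 < v → Prof v =
      r v * ((1 - noArrival q₀ β₁ C (κ v)) * (1 - noPurchase q₀ (κ v))) := fun v hv => by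
    rw [hProf v hv, hη' v hv, hP₀ v hv, noPurchase, mul_assoc]
  have hr' : ∀ v, 0 < v → HasDerivAt r (deriv r v) v := fun v hv =>
    (hdiff.differentiableAt (Ioi_mem_nhds hv)).hasDerivAt
  have hκ' : ∀ v, 0 < v → HasDerivAt κ (κ v * (1 / v - α₂ * deriv r v)) v := fun v hv => by
    have h := (hasDerivAt_id v).fun_mul (((hr' v hv).const_mul α₂).fun_neg.exp)
    refine (h.congr_of_eventuallyEq ?_).congr_deriv ?_
    · filter_upwards [Ioi_mem_nhds hv] with x hx using hκ x hx
    · rw [hκ v hv]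
      simp only [id]
      field_simp
      ring
  have hsale : ∀ v, 0 < v → HasDerivAt
      (fun v => (1 - noArrival q₀ β₁ C (κ v)) * (1 - noPurchase q₀ (κ v)))
      ((1 - noArrival q₀ β₁ C (κ v)) * (1 - noPurchase q₀ (κ v)) *
        saleElasticity q₀ β₁ C (κ v) * (1 / v - α₂ * deriv r v)) v := fun v hv => by
    have hk := hκpos v hv
    refine ((hasDerivAt_sale (β := β₁) hq₀ hC hk).comp v (hκ' v hv)).congr_deriv ?_
    field_simp
  -- the envelope theorem
  have hderiv : ∀ v, 0 < v → HasDerivAt Prof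
      ((1 - noArrival q₀ β₁ C (κ v)) * (1 - noPurchase q₀ (κ v)) / (α₂ * v)) v := fun v hv => by
    refine (((hr' v hv).fun_mul (hsale v hv)).congr_of_eventuallyEq ?_).congr_deriv ?_
    · filter_upwards [Ioi_mem_nhds hv] with x hx using hProf' x hx
    · have hf := hfoc' v hv
      generalize (1 - noArrival q₀ β₁ C (κ v)) * (1 - noPurchase q₀ (κ v)) = g
      generalize saleElasticity q₀ β₁ C (κ v) = G at *
      have : r v * G = 1 / α₂ := by field_simp; linarith
      calc deriv r v * g + r v * (g * G * (1 / v - α₂ * deriv r v))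
          = deriv r v * g + (r v * G) * (g * (1 / v - α₂ * deriv r v)) := by ring
        _ = g / (α₂ * v) := by rw [this]; field_simp; ring
  set K : ℝ := (β₁ * C) ^ (1 / β₁) with hK
  have hKpos : 0 < K := by positivity
  have hlarge : ∀ v, K * Real.exp (K / q₀) < v → β₁ * C < (q₀ + κ v) ^ β₁ := fun v hv => by
    have hv0 : 0 < v := lt_trans (by positivity) hv
    have hk := hκpos v hv0
    have hKlt : K < q₀ + κ v := by
      by_contra! hle
      have hG := noPurchase_lt_saleElasticity hq₀ hβ₁ hC hk
      have hf := hfoc' v hv0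
      have hrp := hr v hv0
      have hαr : α₂ * r v ≤ K / q₀ := by
        have h1 : α₂ * r v * noPurchase q₀ (κ v) ≤ 1 := by
          rw [← hf]; gcongr
        rw [noPurchase, ← mul_div_assoc, div_le_one (by positivity)] at h1
        rw [le_div_iff₀ hq₀]
        linarith
      have hveq : v = κ v * Real.exp (α₂ * r v) := by
        rw [hκ v hv0, mul_assoc, ← Real.exp_add]
        simp
      have : κ v * Real.exp (α₂ * r v) ≤ K * Real.exp (K / q₀) := by
        gcongr
        linarith
      linarith
    have h := rpow_lt_rpow hKpos.le hKlt hβ₁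
    rwa [hK, ← rpow_mul (by positivity), one_div_mul_cancel hβ₁.ne', rpow_one] at h
  have hmain : ∀ v, K * Real.exp (K / q₀) < v → deriv (deriv Prof) v < 0 := fun v hv => by
    have hv0 : 0 < v := lt_trans (by positivity) hv
    have hk := hκpos v hv0
    have hM := hlarge v hv
    obtain ⟨d, hd, hGd⟩ := exists_hasDerivAt_saleElasticity_nonpos hq₀ hβ₁ hC hk hM
    have hG1 := saleElasticity_lt_one hq₀ hC hk hM
    have hG0 := (noPurchase_pos hq₀ hk).trans (noPurchase_lt_saleElasticity hq₀ hβ₁ hC hk)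
    -- differentiating the first-order condition shows that the optimal price increases
    have hr0 : 0 ≤ deriv r v := by
      have h0 : HasDerivAt (fun v => α₂ * r v * saleElasticity q₀ β₁ C (κ v)) 0 v :=
        (hasDerivAt_const v (1 : ℝ)).congr_of_eventuallyEq
          (by filter_upwards [Ioi_mem_nhds hv0] with x hx using hfoc' x hx)
      have h1 := h0.unique (((hr' v hv0).const_mul α₂).fun_mul (hGd.comp v (hκ' v hv0)))
      have hrp := hr v hv0
      by_contra! hneg
      have h2 : 0 < 1 / v - α₂ * deriv r v := by
        have : α₂ * deriv r v < 0 := mul_neg_of_pos_of_neg hα₂ hneg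
        have : 0 < 1 / v := by positivity
        linarith
      have h3 : α₂ * deriv r v * saleElasticity q₀ β₁ C (κ v) < 0 :=
        mul_neg_of_neg_of_pos (mul_neg_of_pos_of_neg hα₂ hneg) hG0
      have h4 : α₂ * r v * (d * (κ v * (1 / v - α₂ * deriv r v))) ≤ 0 :=
        mul_nonpos_of_nonneg_of_nonpos (by positivity)
          (mul_nonpos_of_nonpos_of_nonneg hd (by positivity))
      linarith
    have hev : deriv Prof =ᶠ[nhds v] fun v =>
        (1 - noArrival q₀ β₁ C (κ v)) * (1 - noPurchase q₀ (κ v)) / (α₂ * v) := by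
      filter_upwards [Ioi_mem_nhds hv0] with x hx using (hderiv x hx).deriv
    have hg : 0 < (1 - noArrival q₀ β₁ C (κ v)) * (1 - noPurchase q₀ (κ v)) :=
      mul_pos (sub_pos.2 (noArrival_lt_one hq₀ hC hk)) (sub_pos.2 (noPurchase_lt_one hq₀ hk))
    rw [hev.deriv_eq, ((hsale v hv0).fun_div ((hasDerivAt_id' v).const_mul α₂)
      (by positivity)).deriv]
    refine div_neg_of_neg_of_pos ?_ (by positivity)
    generalize (1 - noArrival q₀ β₁ C (κ v)) * (1 - noPurchase q₀ (κ v)) = g at *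
    generalize saleElasticity q₀ β₁ C (κ v) = G at *
    have heq : g * G * (1 / v - α₂ * deriv r v) * (α₂ * v) - g * (α₂ * 1) =
        -(g * α₂ * (1 - G) + g * G * α₂ * (α₂ * deriv r v) * v) := by
      field_simp
      ring
    rw [heq, neg_lt_zero]
    have := sub_pos.2 hG1
    positivity
  refine ⟨K * Real.exp (K / q₀), by positivity, hmain, ?_⟩
  refine strictConcaveOn_of_deriv2_neg (convex_Ioi _) (fun v hv => ?_) fun v hv => ?_
  · exact (hderiv v (lt_trans (by positivity) hv)).continuousAt.continuousWithinAt
  · rw [interior_Ioi] at hv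
    exact hmain v hv
end
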